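/- arXiv:2604.05554 — 3 statements merged into one kernel-verified Lean document; each statement's English description precedes it below -/
import Mathlib

section
/- There is no continuous function F : X_3 → W_3 (with W_3 carrying the subspace topology from X_3) such that for every K_3-edge (a,b), the pair (F(a),F(b)) is an L_3-edge. -/
open Classical

/-- The space `X₃ = 2^{ℕ³} × 2^ℕ`. -/
abbrev XThree : Type := (ℕ × ℕ × ℕ → Bool) × (ℕ → Bool)

/-- `T^x(m,k) = 0`, i.e. `x(m,k,a) = 1` for some `a`. -/
def lvl2Zero (x : ℕ × ℕ × ℕ → Bool) (m k : ℕ) : Prop := ∃ a : ℕ, x (m, k, a) = true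

/-- `T^x(m) = 0`, i.e. `T^x(m,k) = 1` for some `k`. -/
def lvl1Zero (x : ℕ × ℕ × ℕ → Bool) (m : ℕ) : Prop := ∃ k : ℕ, ¬ lvl2Zero x m k

/-- `T^x(⟨⟩) = 0`, i.e. `T^x(m) = 1` for some `m`. -/
def rootZero (x : ℕ × ℕ × ℕ → Bool) : Prop := ∃ m : ℕ, ¬ lvl1Zero x m

/-- The directed graph `K₃` on `X₃`: `(x,y)` is connected to `(x',y')` iff `x' = x`,
`T^x(⟨⟩) = 0`, and for the least `n` with `T^x(n) = 1`, `y` and `y'` agree except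
at `n`, with `y(n) = 0` and `y'(n) = 1`. -/
def K3Edge (a b : XThree) : Prop :=
  b.1 = a.1 ∧ rootZero a.1 ∧
  ∃ n : ℕ, ¬ lvl1Zero a.1 n ∧ (∀ m < n, lvl1Zero a.1 m) ∧
    a.2 n = false ∧ b.2 n = true ∧ ∀ m : ℕ, m ≠ n → a.2 m = b.2 m

/-- Membership in `W₃`, relative to a coding sequence `M`: for every finite
`m < n^x`, the number `k^x(m)` codes `(y(0),…,y(m))`, i.e. `M_{k^x(m)}` extends it. -/
def memW3 (M : ℕ → ℕ → Bool) (a : XThree) : Prop :=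
  ∀ m k : ℕ, (∀ m' ≤ m, lvl1Zero a.1 m') → ¬ lvl2Zero a.1 m k →
    (∀ k' < k, lvl2Zero a.1 m k') → ∀ i ≤ m, M k i = a.2 i

open Filter Topology in
/-- The points `x` for which `n` is least with `T^x(n) = 1` are dense. -/
theorem dense_setOf_least_not_lvl1Zero (n : ℕ) :
    Dense {x : ℕ × ℕ × ℕ → Bool | ¬ lvl1Zero x n ∧ ∀ m < n, lvl1Zero x m} := by
  intro x
  let u : ℕ → ℕ × ℕ × ℕ → Bool := fun j p =>
    if p.1 < j ∧ p.2.1 < j ∧ p.2.2 < j then x p else decide (p.1 = n)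
  refine mem_closure_of_tendsto (f := u) (b := atTop) ?_ (Eventually.of_forall fun j => ?_)
  · rw [tendsto_pi_nhds]
    rintro ⟨m, k, a⟩
    refine tendsto_nhds_of_eventually_eq ?_
    filter_upwards [eventually_gt_atTop m, eventually_gt_atTop k, eventually_gt_atTop a]
      with j hm hk ha
    simp [u, hm, hk, ha]
  · constructor
    · rintro ⟨k, hk⟩
      exact hk ⟨j, by simp [u]⟩
    · intro m hm
      refine ⟨j, ?_⟩
      rintro ⟨a, ha⟩
      simp [u, hm.ne] at ha

/-- If `n` is least with `T^x(n) = 1`, then setting the `n`-th coordinate of `y` from `0` to `1`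
gives a `K₃`-edge. -/
theorem K3Edge_update {x : ℕ × ℕ × ℕ → Bool} {n : ℕ} (hn : ¬ lvl1Zero x n)
    (hlt : ∀ m < n, lvl1Zero x m) {y : ℕ → Bool} (hy : y n = false) :
    K3Edge (x, y) (x, Function.update y n true) :=
  ⟨rfl, ⟨n, hn⟩, n, hn, hlt, hy, by simp, fun m hm => by simp [hm]⟩

theorem eq_of_least_not_lvl1Zero {x : ℕ × ℕ × ℕ → Bool} {n n' : ℕ}
    (hn : ¬ lvl1Zero x n) (hlt : ∀ m < n, lvl1Zero x m)
    (hn' : ¬ lvl1Zero x n') (hlt' : ∀ m < n', lvl1Zero x m) : n = n' :=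
  le_antisymm (not_lt.1 fun h => hn' (hlt _ h)) (not_lt.1 fun h => hn (hlt' _ h))

/-- For `a ∈ W₃`, the coordinates of `a.2` below `n^{a.1}` are determined by `a.1`. -/
theorem memW3.snd_eq {M : ℕ → ℕ → Bool} {a b : XThree} (ha : memW3 M a) (hb : memW3 M b)
    (hab : a.1 = b.1) {m : ℕ} (hm : ∀ m' ≤ m, lvl1Zero a.1 m') : a.2 m = b.2 m := by
  have hk := hm m le_rfl
  have hmin : ∀ k' < Nat.find hk, lvl2Zero a.1 m k' := fun k' h => not_not.1 (Nat.find_min hk h)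
  rw [← ha m _ hm (Nat.find_spec hk) hmin m le_rfl]
  exact hb m _ (hab ▸ hm) (hab ▸ Nat.find_spec hk) (fun k' h => hab ▸ hmin k' h) m le_rfl

/-- The first coordinate of a continuous homomorphism from `K₃` to itself does not change when a
coordinate of `y` is set to `1`. -/
theorem fst_eq_fst_update {f : XThree → XThree} (hf : Continuous f)
    (hE : ∀ a b, K3Edge a b → K3Edge (f a) (f b)) (x : ℕ × ℕ × ℕ → Bool) {y : ℕ → Bool} {n : ℕ}
    (hy : y n = false) : (f (x, y)).1 = (f (x, Function.update y n true)).1 := by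
  have h := Continuous.ext_on (dense_setOf_least_not_lvl1Zero n)
    (f := fun x => (f (x, y)).1) (g := fun x => (f (x, Function.update y n true)).1)
    (by fun_prop) (by fun_prop)
    (fun x hx => (hE _ _ (K3Edge_update hx.1 hx.2 hy)).1.symm)
  exact congrFun h x

/-- A pair separated at coordinate `N` on an open set yields, on a smaller open set, a pair
separated at a coordinate below `N`. -/
theorem not_separated {M : ℕ → ℕ → Bool} {f : XThree → XThree} (hf : Continuous f)
    (hW : ∀ a, memW3 M (f a)) (hE : ∀ a b, K3Edge a b → K3Edge (f a) (f b)) (N : ℕ) :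
    ∀ (n : ℕ) (U : Set (ℕ × ℕ × ℕ → Bool)), IsOpen U → U.Nonempty →
      ¬ ∀ x ∈ U, (f (x, fun _ => false)).2 N ≠
        (f (x, Function.update (fun _ => false) n true)).2 N := by
  induction N using Nat.strong_induction_on with
  | _ N ih =>
    intro n U hU hne hsep
    obtain ⟨x, hxU, hx, hlt⟩ :=
      (dense_setOf_least_not_lvl1Zero (n + 1)).exists_mem_open hU hne |>.imp fun _ h => h.symm
    obtain ⟨-, -, N', hN', hlt', h0, h1, -⟩ :=
      hE _ _ (K3Edge_update hx hlt (y := fun _ => false) rfl)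
    obtain ⟨-, -, N'', hN'', hlt'', h0', -⟩ :=
      hE _ _ (K3Edge_update hx hlt (y := Function.update (fun _ => false) n true) (by simp))
    have hG := fst_eq_fst_update hf hE x (y := fun _ => false) (n := n) rfl
    rw [← hG] at hN'' hlt''
    obtain rfl := eq_of_least_not_lvl1Zero hN' hlt' hN'' hlt''
    have hle : N' ≤ N := by
      by_contra! h
      exact hsep x hxU ((hW _).snd_eq (hW _) hG fun m hm => hlt' m (hm.trans_lt h))
    have hne' : N' ≠ N := by
      rintro rfl
      exact hsep x hxU (h0.trans h0'.symm)
    refine ih N' (lt_of_le_of_ne hle hne') (n + 1)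
      {z | (f (z, fun _ => false)).2 N' ≠
        (f (z, Function.update (fun _ => false) (n + 1) true)).2 N'}
      (isOpen_ne_fun (by fun_prop) (by fun_prop)) ⟨x, ?_⟩ fun _ hz => hz
    simp [h0, h1]

/-- There is no continuous `F : X₃ → W₃` (with `W₃ ⊆ X₃` carrying
the subspace topology) mapping every `K₃`-edge to an `L₃`-edge (a `K₃`-edge both of
whose endpoints lie in `W₃`). -/
theorem no_continuous_hom_K3_to_L3 (M : ℕ → ℕ → Bool) (hM : DenseRange M) :
    ¬ ∃ F : XThree → {a : XThree // memW3 M a},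
      Continuous F ∧
      ∀ a b : XThree, K3Edge a b →
        (K3Edge (F a).1 (F b).1 ∧ memW3 M (F a).1 ∧ memW3 M (F b).1) := by
  rintro ⟨F, hF, hE⟩
  have hf : Continuous fun a => (F a).1 := continuous_subtype_val.comp hF
  have hK : ∀ a b, K3Edge a b → K3Edge (F a).1 (F b).1 := fun a b h => (hE a b h).1
  obtain ⟨x, hx, hlt⟩ := (dense_setOf_least_not_lvl1Zero 0).nonempty
  obtain ⟨-, -, N, -, -, h0, h1, -⟩ :=
    hK _ _ (K3Edge_update hx hlt (y := fun _ => false) rfl)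
  refine not_separated hf (fun a => (F a).2) hK N 0
    {z | (F (z, fun _ => false)).1.2 N ≠
      (F (z, Function.update (fun _ => false) 0 true)).1.2 N}
    (isOpen_ne_fun (by fun_prop) (by fun_prop)) ⟨x, ?_⟩ fun _ hz => hz
  simp [h0, h1]
end

section
/- For every x : ℕ³ → {0,1}, n^x equals the liminf, as ℓ → ∞, of the sequence n^{x↾ℓ}, computed in ℕ ∪ {∞}, where x↾ℓ denotes the length-ℓ initial segment of x (with respect to the fixed bijection between ℕ and ℕ³). -/
open Classical

/-- `k^{x↾ℓ}(m)`: for the length-`ℓ` initial segment `t` of `x` (with respect to the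
bijection `e : ℕ ≃ ℕ³`), the least `k` such that there is no `a` with `(m,k,a)` in
the domain of `t` and `t(m,k,a) = 1`. -/
noncomputable def kSeg (e : ℕ ≃ ℕ × ℕ × ℕ) (x : ℕ × ℕ × ℕ → Bool) (ℓ m : ℕ) : ℕ :=
  sInf {k : ℕ | ¬ ∃ a : ℕ, e.symm (m, k, a) < ℓ ∧ x (m, k, a) = true}

open Classical in
/-- `n^{x↾ℓ}`: defined by recursion on `ℓ`, following the recursion defining `n^t`
for finite binary strings `t` (applied to the initial segments of `x`). -/
noncomputable def nSeg (e : ℕ ≃ ℕ × ℕ × ℕ) (x : ℕ × ℕ × ℕ → Bool) : ℕ → ℕ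
  | 0 => 0
  | ℓ + 1 =>
    if ∃ m < nSeg e x ℓ, ∃ a : ℕ, e.symm (m, kSeg e x ℓ m, a) < ℓ + 1 ∧
        x (m, kSeg e x ℓ m, a) = true then
      sInf {m : ℕ | m < nSeg e x ℓ ∧ ∃ a : ℕ, e.symm (m, kSeg e x ℓ m, a) < ℓ + 1 ∧
        x (m, kSeg e x ℓ m, a) = true}
    else nSeg e x ℓ + 1

/-- `n^x ∈ ℕ ∪ {∞}`: the supremum of the set of `n` such that `T^x(m) = 0` for
all `m < n`. -/
noncomputable def nVal (x : ℕ × ℕ × ℕ → Bool) : ℕ∞ :=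
  sSup {N : ℕ∞ | ∃ n : ℕ, N = (n : ℕ∞) ∧ ∀ m < n, lvl1Zero x m}

open Filter in
/-- If `T^x(m) = 0`, then the current value of `kSeg` at `m` is eventually never refuted. -/
theorem eventually_kSeg_not_lvl2Zero (e : ℕ ≃ ℕ × ℕ × ℕ) {x : ℕ × ℕ × ℕ → Bool} {m : ℕ}
    (h : lvl1Zero x m) : ∀ᶠ ℓ in atTop, ¬ lvl2Zero x m (kSeg e x ℓ m) := by
  have hlt : ∀ k < Nat.find h, ∀ᶠ ℓ in atTop, ∃ a, e.symm (m, k, a) < ℓ ∧ x (m, k, a) = true := by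
    intro k hk
    obtain ⟨a, ha⟩ := not_not.mp (Nat.find_min h hk)
    filter_upwards [eventually_gt_atTop (e.symm (m, k, a))] with ℓ hℓ
    exact ⟨a, hℓ, ha⟩
  filter_upwards [(Set.finite_lt_nat (Nat.find h)).eventually_all.mpr hlt] with ℓ hℓ
  have hmem : Nat.find h ∈ {k : ℕ | ¬ ∃ a : ℕ, e.symm (m, k, a) < ℓ ∧ x (m, k, a) = true} :=
    fun ⟨a, _, ha⟩ => Nat.find_spec h ⟨a, ha⟩
  have heq : kSeg e x ℓ m = Nat.find h := by
    refine le_antisymm (Nat.sInf_le hmem) (le_csInf ⟨_, hmem⟩ fun k hk => ?_)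
    by_contra! hlt'
    exact hk (hℓ k hlt')
  rw [heq]
  exact Nat.find_spec h

theorem kSeg_succ_eq {e : ℕ ≃ ℕ × ℕ × ℕ} {x : ℕ × ℕ × ℕ → Bool} {ℓ m : ℕ}
    (h : ¬ ∃ a : ℕ, e.symm (m, kSeg e x ℓ m, a) < ℓ + 1 ∧ x (m, kSeg e x ℓ m, a) = true) :
    kSeg e x (ℓ + 1) m = kSeg e x ℓ m := by
  refine le_antisymm (Nat.sInf_le h) (le_csInf ⟨_, h⟩ fun k hk => Nat.sInf_le ?_)
  rintro ⟨a, ha, hx⟩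
  exact hk ⟨a, by omega, hx⟩

/-- If `T^x(m) = 1`, then the current value of `kSeg` at `m` is refuted infinitely often. -/
theorem exists_kSeg_hit (e : ℕ ≃ ℕ × ℕ × ℕ) {x : ℕ × ℕ × ℕ → Bool} {m : ℕ}
    (h : ¬ lvl1Zero x m) (L : ℕ) :
    ∃ ℓ ≥ L, ∃ a : ℕ, e.symm (m, kSeg e x ℓ m, a) < ℓ + 1 ∧ x (m, kSeg e x ℓ m, a) = true := by
  by_contra! hno
  have hconst : ∀ ℓ ≥ L, kSeg e x ℓ m = kSeg e x L m := by
    intro ℓ hℓ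
    induction ℓ, hℓ using Nat.le_induction with
    | base => rfl
    | succ ℓ hℓ ih =>
      rw [kSeg_succ_eq, ih]
      rintro ⟨a, ha, hx⟩
      exact hno ℓ hℓ a ha hx
  obtain ⟨a, ha⟩ : lvl2Zero x m (kSeg e x L m) := by
    by_contra hk
    exact h ⟨_, hk⟩
  have hle := le_max_left L (e.symm (m, kSeg e x L m, a))
  refine hno _ hle a ?_ ?_ <;> rw [hconst _ hle]
  · exact Nat.lt_succ_of_le (le_max_right _ _)
  · exact ha

theorem nSeg_succ_le {e : ℕ ≃ ℕ × ℕ × ℕ} {x : ℕ × ℕ × ℕ → Bool} {ℓ m : ℕ} (hm : m < nSeg e x ℓ)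
    (h : ∃ a : ℕ, e.symm (m, kSeg e x ℓ m, a) < ℓ + 1 ∧ x (m, kSeg e x ℓ m, a) = true) :
    nSeg e x (ℓ + 1) ≤ m := by
  rw [nSeg, if_pos ⟨m, hm, h⟩]
  exact Nat.sInf_le ⟨hm, h⟩

theorem min_le_nSeg_succ {e : ℕ ≃ ℕ × ℕ × ℕ} {x : ℕ × ℕ × ℕ → Bool} {ℓ n : ℕ}
    (h : ∀ m < n, ¬ lvl2Zero x m (kSeg e x ℓ m)) :
    min n (nSeg e x ℓ + 1) ≤ nSeg e x (ℓ + 1) := by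
  rw [nSeg]
  split_ifs with hc
  · obtain ⟨m, hm⟩ := hc
    refine (min_le_left _ _).trans (le_csInf ⟨m, hm⟩ ?_)
    rintro k ⟨-, a, -, ha⟩
    by_contra! hk
    exact h k hk ⟨a, ha⟩
  · exact min_le_right _ _

open Filter in
theorem eventually_le_nSeg (e : ℕ ≃ ℕ × ℕ × ℕ) {x : ℕ × ℕ × ℕ → Bool} {n : ℕ}
    (h : ∀ m < n, lvl1Zero x m) : ∀ᶠ ℓ in atTop, n ≤ nSeg e x ℓ := by
  obtain ⟨L, hL⟩ := eventually_atTop.mp ((Set.finite_lt_nat n).eventually_all.mpr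
    fun m hm => eventually_kSeg_not_lvl2Zero e (h m hm))
  have hgrow : ∀ j, min n j ≤ nSeg e x (L + j) := by
    intro j
    induction j with
    | zero => simp
    | succ j ih =>
      have := min_le_nSeg_succ (e := e) (hL (L + j) (Nat.le_add_right _ _))
      rw [← add_assoc]
      omega
  filter_upwards [eventually_ge_atTop (L + n)] with ℓ hℓ
  have := hgrow (ℓ - L)
  rw [Nat.add_sub_cancel' (by omega)] at this
  omega

open Filter in
theorem lvl1Zero_of_eventually_lt_nSeg {e : ℕ ≃ ℕ × ℕ × ℕ} {x : ℕ × ℕ × ℕ → Bool} {m : ℕ}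
    (h : ∀ᶠ ℓ in atTop, m < nSeg e x ℓ) : lvl1Zero x m := by
  by_contra hm
  obtain ⟨L, hL⟩ := eventually_atTop.mp h
  obtain ⟨ℓ, hℓ, hhit⟩ := exists_kSeg_hit e hm L
  exact (nSeg_succ_le (hL ℓ hℓ) hhit).not_gt (hL (ℓ + 1) (by omega))

/-- For every `x : ℕ³ → 2`, `n^x` equals the liminf (in `ℕ ∪ {∞}`)
of the sequence `n^{x↾ℓ}` of approximations along the initial segments of `x`. -/
theorem nVal_eq_liminf_nSeg (e : ℕ ≃ ℕ × ℕ × ℕ) (x : ℕ × ℕ × ℕ → Bool) :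
    nVal x = Filter.liminf (fun ℓ : ℕ => ((nSeg e x ℓ : ℕ) : ℕ∞)) Filter.atTop := by
  refine le_antisymm (sSup_le ?_) (Filter.liminf_le_of_le (by isBoundedDefault) fun b hb => ?_)
  · rintro _ ⟨n, rfl, hn⟩
    refine Filter.le_liminf_of_le (by isBoundedDefault) ?_
    filter_upwards [eventually_le_nSeg e hn] with ℓ hℓ
    exact_mod_cast hℓ
  · obtain ⟨ℓ, hℓ⟩ := hb.exists
    lift b to ℕ using ne_top_of_le_ne_top (ENat.natCast_ne_top _) hℓ
    refine le_sSup ⟨b, rfl, fun m hm => lvl1Zero_of_eventually_lt_nSeg (e := e) ?_⟩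
    filter_upwards [hb] with ℓ hℓ
    exact hm.trans_le (by exact_mod_cast hℓ)
end

section
/- There is no countable Σ^0_3 colouring of H_3: there is no countable family (C_n)_{n∈ℕ} of Σ^0_3 subsets of X_3 with Y_3 ⊆ ⋃_n C_n such that no C_n contains both endpoints of an H_3-edge. -/
open Classical

/-- `k^x(m)`: the least `k` with `T^x(m,k) = 1`. -/
noncomputable def kVal (x : ℕ × ℕ × ℕ → Bool) (m : ℕ) : ℕ :=
  sInf {k : ℕ | ¬ lvl2Zero x m k}

/-- `(x↾ℓ) ⊑_m x`: the length-`ℓ` initial segment `s` of `x` satisfies `m ≤ n^s`,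
`m ≤ n^x`, and `k^s(j) = k^x(j)` for all `j < m`. -/
def sqSub (e : ℕ ≃ ℕ × ℕ × ℕ) (x : ℕ × ℕ × ℕ → Bool) (m ℓ : ℕ) : Prop :=
  m ≤ nSeg e x ℓ ∧ (m : ℕ∞) ≤ nVal x ∧ ∀ j < m, kSeg e x ℓ j = kVal x j

/-- `c^x(m)`: the least length of an initial segment `s` of `x` with `s ⊑_m x`. -/
noncomputable def cVal (e : ℕ ≃ ℕ × ℕ × ℕ) (x : ℕ × ℕ × ℕ → Bool) (m : ℕ) : ℕ :=
  sInf {ℓ : ℕ | sqSub e x m ℓ}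

/-- Membership in `Y₃`: for every finite `m < n^x`, the number `k^x(m)` codes the
string `(y(0),…,y(c^x(m)))`, i.e. `M_{k^x(m)}` extends it. -/
def memY3 (e : ℕ ≃ ℕ × ℕ × ℕ) (M : ℕ → ℕ → Bool) (a : XThree) : Prop :=
  ∀ m : ℕ, (m : ℕ∞) < nVal a.1 → ∀ i ≤ cVal e a.1 m, M (kVal a.1 m) i = a.2 i

/-- The directed graph `H₃` on `X₃`: `(x,y)` is connected to `(x',y')` iff both are
in `Y₃`, `x' = x`, `n^x` is finite, and `y, y'` agree except at `c^x(n^x)`, with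
`y(c^x(n^x)) = 0` and `y'(c^x(n^x)) = 1`. -/
def H3Edge (e : ℕ ≃ ℕ × ℕ × ℕ) (M : ℕ → ℕ → Bool) (a b : XThree) : Prop :=
  memY3 e M a ∧ memY3 e M b ∧ b.1 = a.1 ∧
  ∃ n : ℕ, nVal a.1 = (n : ℕ∞) ∧
    a.2 (cVal e a.1 n) = false ∧ b.2 (cVal e a.1 n) = true ∧
    ∀ i : ℕ, i ≠ cVal e a.1 n → a.2 i = b.2 i

/-- The classes `Σ^0_β` of subsets of a topological space, defined by transfinite
recursion: `Σ^0_1` is the class of open sets, and for `β > 1`, a set is `Σ^0_β`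
iff it is a countable union of complements of sets in classes `Σ^0_γ`, `1 ≤ γ < β`. -/
inductive SigmaClass (X : Type*) [TopologicalSpace X] : Ordinal → Set X → Prop
  | open_ (s : Set X) (hs : IsOpen s) : SigmaClass X 1 s
  | union (β : Ordinal) (γ : ℕ → Ordinal) (s : ℕ → Set X)
      (hβ : 1 < β) (hγ1 : ∀ n : ℕ, 1 ≤ γ n) (hγ : ∀ n : ℕ, γ n < β)
      (hs : ∀ n : ℕ, SigmaClass X (γ n) (s n)) :
      SigmaClass X β (⋃ n : ℕ, (s n)ᶜ)

/-! ### Borel classes -/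

theorem SigmaClass.isOpen_of_one {X : Type*} [TopologicalSpace X] {γ : Ordinal} {s : Set X}
    (h : SigmaClass X γ s) (hγ : γ ≤ 1) : IsOpen s := by
  cases h with
  | open_ _ hs => exact hs
  | union _ _ _ hβ => exact absurd hβ (not_lt.2 hγ)

theorem SigmaClass.isGδ_compl {γ : Ordinal} {s : Set XThree}
    (h : SigmaClass XThree γ s) (hγ : γ < 3) : IsGδ sᶜ := by
  cases h with
  | open_ _ hs => exact hs.isClosed_compl.isGδ
  | union _ δ t hβ hδ1 hδ ht =>
    have hγ2 : γ ≤ 1 + 1 := Order.lt_add_one_iff.1 (hγ.trans_eq (by norm_num))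
    have hopen : ∀ n, IsOpen (t n) := fun n =>
      (ht n).isOpen_of_one (Order.lt_add_one_iff.1 ((hδ n).trans_le hγ2))
    rw [Set.compl_iUnion]
    simpa using IsGδ.iInter_of_isOpen hopen

theorem SigmaClass.exists_iUnion_isGδ {s : Set XThree} (h : SigmaClass XThree 3 s) :
    ∃ G : ℕ → Set XThree, s = ⋃ n, G n ∧ ∀ n, IsGδ (G n) := by
  generalize hβ : (3 : Ordinal) = β at h
  cases h with
  | open_ => norm_num at hβ
  | union _ δ t _ _ hδ ht =>
    exact ⟨_, rfl, fun n => (ht n).isGδ_compl (hβ ▸ hδ n)⟩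

/-! ### Coding and cylinders -/

theorem exists_ge_code {M : ℕ → ℕ → Bool} (hM : DenseRange M) (y : ℕ → Bool) (c N : ℕ) :
    ∃ k ≥ N, ∀ i ≤ c, M k i = y i := by
  let z : ℕ → Bool := fun i => if i ≤ c then y i else !(M (i - (c + 1)) i)
  have hopen : IsOpen ((Set.Iic (c + N)).pi fun i => ({z i} : Set Bool)) :=
    isOpen_set_pi (Set.finite_Iic _) fun _ _ => isOpen_discrete _
  obtain ⟨k, hk⟩ := hM.exists_mem_open hopen ⟨z, fun _ _ => rfl⟩
  have hk' : ∀ i ≤ c + N, M k i = z i := fun i hi => hk i hi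
  refine ⟨k, ?_, fun i hi => ?_⟩
  · by_contra! hkN
    have := hk' (c + 1 + k) (by omega)
    simp [z, show ¬ c + 1 + k ≤ c by omega] at this
  · rw [hk' i (by omega)]
    simp [z, hi]

/-- `a` and `b` agree up to `L` in both coordinates. -/
def AgreeBelow (e : ℕ ≃ ℕ × ℕ × ℕ) (L : ℕ) (a b : XThree) : Prop :=
  (∀ p, e.symm p < L → b.1 p = a.1 p) ∧ ∀ i < L, b.2 i = a.2 i

theorem exists_cylinder_subset {ι : Type*} (e : ℕ ≃ ι) {U : Set (ι → Bool)} (hU : IsOpen U)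
    {x : ι → Bool} (hx : x ∈ U) :
    ∃ L, ∀ x' : ι → Bool, (∀ p, e.symm p < L → x' p = x p) → x' ∈ U := by
  obtain ⟨I, u, hu, hsub⟩ := isOpen_pi_iff.1 hU x hx
  refine ⟨I.sup (fun p => e.symm p + 1), fun x' hx' => hsub fun p hp => ?_⟩
  have : e.symm p + 1 ≤ I.sup (fun p => e.symm p + 1) :=
    Finset.le_sup (f := fun p => e.symm p + 1) hp
  rw [hx' p (by omega)]
  exact (hu p hp).2

theorem exists_agreeBelow_subset (e : ℕ ≃ ℕ × ℕ × ℕ) {V : Set XThree} (hV : IsOpen V)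
    {a : XThree} (ha : a ∈ V) : ∃ L, ∀ b, AgreeBelow e L a b → b ∈ V := by
  obtain ⟨U₁, U₂, h₁, h₂, ha₁, ha₂, hsub⟩ := isOpen_prod_iff.1 hV a.1 a.2 ha
  obtain ⟨L₁, hL₁⟩ := exists_cylinder_subset e h₁ ha₁
  obtain ⟨L₂, hL₂⟩ := exists_cylinder_subset (Equiv.refl ℕ) h₂ ha₂
  refine ⟨max L₁ L₂, fun b hb => hsub ⟨hL₁ _ fun p hp => hb.1 p ?_, hL₂ _ fun i hi => hb.2 i ?_⟩⟩
  · omega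
  · simp at hi; omega

theorem exists_bound_index (e : ℕ ≃ ℕ × ℕ × ℕ) (L : ℕ) :
    ∃ K, ∀ m k a, e.symm (m, k, a) < L → k < K ∧ a < K := by
  refine ⟨(Finset.range L).sup (fun i => (e i).2.1 + (e i).2.2 + 1), fun m k a h => ?_⟩
  have := Finset.le_sup (f := fun i => (e i).2.1 + (e i).2.2 + 1) (Finset.mem_range.2 h)
  simp only [Equiv.apply_symm_apply] at this
  omega

theorem exists_index_ge (e : ℕ ≃ ℕ × ℕ × ℕ) (L m k : ℕ) : ∃ a, L ≤ e.symm (m, k, a) := by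
  obtain ⟨K, hK⟩ := exists_bound_index e L
  refine ⟨K, ?_⟩
  by_contra! h
  exact lt_irrefl _ (hK _ _ _ h).2

/-! ### The functions `n`, `k` and `c` -/

theorem natCast_le_nVal {x : ℕ × ℕ × ℕ → Bool} {m : ℕ} :
    (m : ℕ∞) ≤ nVal x ↔ ∀ j < m, lvl1Zero x j := by
  refine ⟨fun h j hj => ?_, fun h => le_sSup ⟨m, rfl, h⟩⟩
  by_contra hx
  have : nVal x ≤ j := sSup_le <| by
    rintro _ ⟨n, rfl, hn⟩
    by_contra! hlt
    exact hx (hn j (by exact_mod_cast hlt))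
  have := h.trans this
  norm_cast at this
  omega

theorem natCast_lt_nVal {x : ℕ × ℕ × ℕ → Bool} {m : ℕ} :
    (m : ℕ∞) < nVal x ↔ ∀ j ≤ m, lvl1Zero x j := by
  rw [← ENat.add_one_le_iff (ENat.natCast_ne_top m)]
  have := natCast_le_nVal (x := x) (m := m + 1)
  push_cast at this
  rw [this]
  simp

theorem nVal_eq {x : ℕ × ℕ × ℕ → Bool} {m : ℕ} (h : ∀ j < m, lvl1Zero x j)
    (hm : ¬ lvl1Zero x m) : nVal x = m :=
  le_antisymm (not_lt.1 fun hlt => hm (natCast_lt_nVal.1 hlt m le_rfl)) (natCast_le_nVal.2 h)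

theorem kVal_spec {x : ℕ × ℕ × ℕ → Bool} {m : ℕ} (h : lvl1Zero x m) :
    ¬ lvl2Zero x m (kVal x m) :=
  Nat.sInf_mem (s := {k | ¬ lvl2Zero x m k}) h

theorem kVal_eq {x : ℕ × ℕ × ℕ → Bool} {m k : ℕ} (h : ¬ lvl2Zero x m k)
    (hk : ∀ k' < k, lvl2Zero x m k') : kVal x m = k := by
  refine le_antisymm (Nat.sInf_le h) ?_
  by_contra! hlt
  exact kVal_spec ⟨k, h⟩ (hk _ hlt)

theorem lvl2Zero_of_lt_kVal {x : ℕ × ℕ × ℕ → Bool} {m k : ℕ} (h : k < kVal x m) :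
    lvl2Zero x m k := by
  by_contra hk
  exact Nat.notMem_of_lt_sInf h hk

section Segments

variable (e : ℕ ≃ ℕ × ℕ × ℕ) (x : ℕ × ℕ × ℕ → Bool)

theorem kSeg_le {ℓ m k : ℕ} (h : ∀ a, e.symm (m, k, a) < ℓ → x (m, k, a) ≠ true) :
    kSeg e x ℓ m ≤ k :=
  Nat.sInf_le (s := {k | ¬ ∃ a, e.symm (m, k, a) < ℓ ∧ x (m, k, a) = true})
    fun ⟨a, ha, hx⟩ => h a ha hx

theorem kSeg_spec (ℓ m : ℕ) (a : ℕ) (ha : e.symm (m, kSeg e x ℓ m, a) < ℓ) :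
    x (m, kSeg e x ℓ m, a) ≠ true := by
  have hne : {k | ¬ ∃ a, e.symm (m, k, a) < ℓ ∧ x (m, k, a) = true}.Nonempty := by
    obtain ⟨K, hK⟩ := exists_bound_index e ℓ
    exact ⟨K, fun ⟨a, ha, _⟩ => lt_irrefl _ (hK _ _ _ ha).1⟩
  exact fun h => Nat.sInf_mem hne ⟨a, ha, h⟩

theorem exists_of_lt_kSeg {ℓ m k : ℕ} (h : k < kSeg e x ℓ m) :
    ∃ a, e.symm (m, k, a) < ℓ ∧ x (m, k, a) = true := by
  by_contra hk
  exact Nat.notMem_of_lt_sInf h hk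

theorem kSeg_mono {ℓ ℓ' : ℕ} (h : ℓ ≤ ℓ') (m : ℕ) : kSeg e x ℓ m ≤ kSeg e x ℓ' m :=
  kSeg_le e x fun a ha => kSeg_spec e x ℓ' m a (ha.trans_le h)

theorem nSeg_succ_cases (ℓ : ℕ) :
    (nSeg e x (ℓ + 1) < nSeg e x ℓ ∧
      kSeg e x (ℓ + 1) (nSeg e x (ℓ + 1)) ≠ kSeg e x ℓ (nSeg e x (ℓ + 1)) ∧
      ∀ j < nSeg e x (ℓ + 1), kSeg e x (ℓ + 1) j = kSeg e x ℓ j) ∨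
    (nSeg e x (ℓ + 1) = nSeg e x ℓ + 1 ∧
      ∀ j < nSeg e x ℓ, kSeg e x (ℓ + 1) j = kSeg e x ℓ j) := by
  have stable : ∀ j, (¬ ∃ a : ℕ, e.symm (j, kSeg e x ℓ j, a) < ℓ + 1 ∧
      x (j, kSeg e x ℓ j, a) = true) → kSeg e x (ℓ + 1) j = kSeg e x ℓ j := fun j hj =>
    le_antisymm (kSeg_le e x fun a ha hx => hj ⟨a, ha, hx⟩) (kSeg_mono e x ℓ.le_succ j)
  by_cases h : ∃ m < nSeg e x ℓ, ∃ a : ℕ, e.symm (m, kSeg e x ℓ m, a) < ℓ + 1 ∧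
      x (m, kSeg e x ℓ m, a) = true
  · left
    set S := {m : ℕ | m < nSeg e x ℓ ∧ ∃ a : ℕ, e.symm (m, kSeg e x ℓ m, a) < ℓ + 1 ∧
      x (m, kSeg e x ℓ m, a) = true} with hS
    have heq : nSeg e x (ℓ + 1) = sInf S := by rw [nSeg, if_pos h]
    obtain ⟨hlt, a, ha, hx⟩ : sInf S ∈ S := Nat.sInf_mem h
    rw [heq]
    refine ⟨hlt, fun hk => ?_, fun j hj => stable j fun hj' => ?_⟩
    · rw [← hk] at ha hx
      exact kSeg_spec e x _ _ a ha hx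
    · exact Nat.notMem_of_lt_sInf hj ⟨hj.trans hlt, hj'⟩
  · right
    refine ⟨by rw [nSeg, if_neg h], fun j hj => stable j fun hj' => h ⟨j, hj, hj'⟩⟩

theorem exists_kSeg_eq_kVal {j : ℕ} (h : lvl1Zero x j) :
    ∃ ℓ₀, ∀ ℓ ≥ ℓ₀, kSeg e x ℓ j = kVal x j := by
  have hw : ∀ k, ∃ a, k < kVal x j → x (j, k, a) = true := fun k => by
    by_cases hk : k < kVal x j
    · obtain ⟨a, ha⟩ := lvl2Zero_of_lt_kVal hk
      exact ⟨a, fun _ => ha⟩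
    · exact ⟨0, fun h => absurd h hk⟩
  choose w hw using hw
  refine ⟨(Finset.range (kVal x j)).sup (fun k => e.symm (j, k, w k) + 1), fun ℓ hℓ => ?_⟩
  refine le_antisymm (kSeg_le e x fun a _ hx => kVal_spec h ⟨a, hx⟩) ?_
  by_contra! hlt
  have := Finset.le_sup (f := fun k => e.symm (j, k, w k) + 1) (Finset.mem_range.2 hlt)
  exact kSeg_spec e x ℓ j (w _) (by omega) (hw _ hlt)

theorem exists_sqSub {m : ℕ} (h : ∀ j < m, lvl1Zero x j) : ∃ ℓ, sqSub e x m ℓ := by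
  have hex : ∀ j, ∃ ℓ₀, j < m → ∀ ℓ ≥ ℓ₀, kSeg e x ℓ j = kVal x j := fun j => by
    by_cases hj : j < m
    · obtain ⟨ℓ₀, h₀⟩ := exists_kSeg_eq_kVal e x (h j hj)
      exact ⟨ℓ₀, fun _ => h₀⟩
    · exact ⟨0, fun h => absurd h hj⟩
  choose g hg using hex
  set ℓ₀ := (Finset.range m).sup g
  have hk : ∀ j < m, ∀ ℓ ≥ ℓ₀, kSeg e x ℓ j = kVal x j := fun j hj ℓ hℓ =>
    hg j hj ℓ ((Finset.le_sup (Finset.mem_range.2 hj)).trans hℓ)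
  have hn : ∀ i, min m i ≤ nSeg e x (ℓ₀ + i) := by
    intro i
    induction i with
    | zero => simp
    | succ i ih =>
      rcases nSeg_succ_cases e x (ℓ₀ + i) with ⟨_, hne, _⟩ | ⟨heq, _⟩
      · have : m ≤ nSeg e x (ℓ₀ + i + 1) := by
          by_contra! hlt
          exact hne ((hk _ hlt _ (by omega)).trans (hk _ hlt _ (by omega)).symm)
        rw [← add_assoc]
        omega
      · rw [← add_assoc]
        omega
  exact ⟨ℓ₀ + m, by simpa using hn m, natCast_le_nVal.2 h, fun j hj => hk j hj _ (by omega)⟩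

theorem sqSub_cVal {m : ℕ} (h : ∀ j < m, lvl1Zero x j) : sqSub e x m (cVal e x m) :=
  Nat.sInf_mem (s := {ℓ | sqSub e x m ℓ}) (exists_sqSub e x h)

theorem cVal_le {m ℓ : ℕ} (h : sqSub e x m ℓ) : cVal e x m ≤ ℓ :=
  Nat.sInf_le (s := {ℓ | sqSub e x m ℓ}) h

theorem cVal_lt_succ {m : ℕ} (h : ∀ j < m + 1, lvl1Zero x j) :
    cVal e x m < cVal e x (m + 1) := by
  obtain ⟨hn, _, hk⟩ := sqSub_cVal e x h
  cases hc : cVal e x (m + 1) with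
  | zero => rw [hc, nSeg] at hn; omega
  | succ ℓ =>
    rw [hc] at hn hk
    refine Nat.lt_succ_of_le (cVal_le e x ⟨?_, natCast_le_nVal.2 fun j hj => h j (by omega),
      fun j hj => ?_⟩)
    · rcases nSeg_succ_cases e x ℓ with ⟨h', _⟩ | ⟨h', _⟩ <;> omega
    · rw [← hk j (by omega)]
      rcases nSeg_succ_cases e x ℓ with ⟨_, _, h'⟩ | ⟨_, h'⟩ <;> exact (h' j (by omega)).symm

theorem cVal_lt {m : ℕ} (h : ∀ j < m, lvl1Zero x j) {j : ℕ} (hj : j < m) :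
    cVal e x j < cVal e x m := by
  induction m with
  | zero => omega
  | succ m ih =>
    have hlt := cVal_lt_succ e x h
    rcases Nat.lt_succ_iff_lt_or_eq.1 hj with hj | rfl
    · exact (ih (fun i hi => h i (by omega)) hj).trans hlt
    · exact hlt

variable {e x}

theorem kSeg_congr {x' : ℕ × ℕ × ℕ → Bool} {L ℓ : ℕ} (h : ∀ p, e.symm p < L → x' p = x p)
    (hℓ : ℓ ≤ L) (m : ℕ) : kSeg e x' ℓ m = kSeg e x ℓ m :=
  le_antisymm
    (kSeg_le e x' fun a ha => by rw [h _ (by omega)]; exact kSeg_spec e x ℓ m a ha)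
    (kSeg_le e x fun a ha => by rw [← h _ (by omega)]; exact kSeg_spec e x' ℓ m a ha)

theorem nSeg_congr {x' : ℕ × ℕ × ℕ → Bool} {L : ℕ} (h : ∀ p, e.symm p < L → x' p = x p)
    {ℓ : ℕ} (hℓ : ℓ ≤ L) : nSeg e x' ℓ = nSeg e x ℓ := by
  induction ℓ with
  | zero => rfl
  | succ ℓ ih =>
    have hiff : ∀ m a, (e.symm (m, kSeg e x' ℓ m, a) < ℓ + 1 ∧ x' (m, kSeg e x' ℓ m, a) = true) ↔
        (e.symm (m, kSeg e x ℓ m, a) < ℓ + 1 ∧ x (m, kSeg e x ℓ m, a) = true) := fun m a => by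
      rw [kSeg_congr h (by omega)]
      exact and_congr_right fun hlt => by rw [h _ (by omega)]
    simp only [nSeg, hiff, ih (by omega)]

theorem sqSub_congr {x' : ℕ × ℕ × ℕ → Bool} {L ℓ m : ℕ} (h : ∀ p, e.symm p < L → x' p = x p)
    (hx : ∀ j < m, lvl1Zero x j) (hx' : ∀ j < m, lvl1Zero x' j)
    (hk : ∀ j < m, kVal x' j = kVal x j) (hℓ : ℓ ≤ L) :
    sqSub e x' m ℓ ↔ sqSub e x m ℓ := by
  unfold sqSub
  rw [nSeg_congr h hℓ]
  refine and_congr_right fun _ => and_congr (iff_of_true (natCast_le_nVal.2 hx')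
    (natCast_le_nVal.2 hx)) (forall₂_congr fun j hj => ?_)
  rw [kSeg_congr h hℓ, hk j hj]

theorem cVal_congr {x' : ℕ × ℕ × ℕ → Bool} {L m : ℕ} (h : ∀ p, e.symm p < L → x' p = x p)
    (hx : ∀ j < m, lvl1Zero x j) (hx' : ∀ j < m, lvl1Zero x' j)
    (hk : ∀ j < m, kVal x' j = kVal x j) (hc : cVal e x m ≤ L) :
    cVal e x' m = cVal e x m := by
  have hle : cVal e x' m ≤ cVal e x m :=
    cVal_le e x' ((sqSub_congr h hx hx' hk hc).2 (sqSub_cVal e x hx))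
  exact le_antisymm hle
    (cVal_le e x ((sqSub_congr h hx hx' hk (hle.trans hc)).1 (sqSub_cVal e x' hx')))

end Segments

/-! ### Conditions -/

/-- A forcing condition: the first `len` values of `x`, the first `c^x(lev)` values of `y`, and
the promise that `k^x(j)` is preserved for `j < lev`. -/
structure Cond (e : ℕ ≃ ℕ × ℕ × ℕ) (M : ℕ → ℕ → Bool) where
  /-- The first coordinate of the representing point. -/
  x : ℕ × ℕ × ℕ → Bool
  /-- The second coordinate of the representing point. -/
  y : ℕ → Bool
  /-- The length of the initial segment of `x` that is fixed. -/
  len : ℕ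
  /-- The number of values `k^x(j)` that are fixed. -/
  lev : ℕ
  lvl1Zero_of_lt : ∀ j < lev, lvl1Zero x j
  cVal_le_len : cVal e x lev ≤ len
  codes : ∀ j < lev, ∀ i ≤ cVal e x j, M (kVal x j) i = y i

namespace Cond

variable {e : ℕ ≃ ℕ × ℕ × ℕ} {M : ℕ → ℕ → Bool} (p : Cond e M) {a b : XThree}

/-- The closed set of points compatible with a condition. -/
def body : Set XThree :=
  {a | (∀ q, e.symm q < p.len → a.1 q = p.x q) ∧ (∀ i < cVal e p.x p.lev, a.2 i = p.y i) ∧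
    ∀ j < p.lev, ∀ i, a.1 (j, kVal p.x j, i) = false}

theorem mem_body_self : (p.x, p.y) ∈ p.body :=
  ⟨fun _ _ => rfl, fun _ _ => rfl, fun j hj i => by
    have := kVal_spec (p.lvl1Zero_of_lt j hj)
    by_contra h
    exact this ⟨i, by simpa using h⟩⟩

theorem isClosed_body : IsClosed p.body := by
  simp only [body, Set.ofPred_and, Set.ofPred_forall]
  refine IsClosed.inter ?_ (IsClosed.inter ?_ ?_)
  · exact isClosed_iInter fun _ => isClosed_iInter fun _ =>
      isClosed_eq (by fun_prop) (by fun_prop)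
  · exact isClosed_iInter fun _ => isClosed_iInter fun _ =>
      isClosed_eq (by fun_prop) (by fun_prop)
  · exact isClosed_iInter fun _ => isClosed_iInter fun _ => isClosed_iInter fun _ =>
      isClosed_eq (by fun_prop) (by fun_prop)

variable {p}

theorem not_lvl2Zero (ha : a ∈ p.body) {j : ℕ} (hj : j < p.lev) :
    ¬ lvl2Zero a.1 j (kVal p.x j) :=
  fun ⟨i, hi⟩ => by simp [ha.2.2 j hj i] at hi

theorem lvl1Zero_of_mem (ha : a ∈ p.body) {j : ℕ} (hj : j < p.lev) : lvl1Zero a.1 j :=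
  ⟨_, not_lvl2Zero ha hj⟩

theorem kVal_of_mem (ha : a ∈ p.body) {j : ℕ} (hj : j < p.lev) : kVal a.1 j = kVal p.x j := by
  refine kVal_eq (not_lvl2Zero ha hj) fun k hk => ?_
  have hs := (sqSub_cVal e p.x p.lvl1Zero_of_lt).2.2 j hj
  rw [← hs] at hk
  obtain ⟨i, hi, hx⟩ := exists_of_lt_kSeg e p.x hk
  exact ⟨i, by rw [ha.1 _ (hi.trans_le p.cVal_le_len), hx]⟩

theorem cVal_le_lev (p : Cond e M) {j : ℕ} (hj : j ≤ p.lev) :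
    cVal e p.x j ≤ cVal e p.x p.lev := by
  rcases hj.eq_or_lt with rfl | hj
  · exact le_rfl
  · exact (cVal_lt e p.x p.lvl1Zero_of_lt hj).le

theorem cVal_of_mem (ha : a ∈ p.body) {j : ℕ} (hj : j ≤ p.lev) :
    cVal e a.1 j = cVal e p.x j :=
  cVal_congr ha.1 (fun i hi => p.lvl1Zero_of_lt i (by omega))
    (fun i hi => lvl1Zero_of_mem ha (by omega)) (fun i hi => kVal_of_mem ha (by omega))
    ((p.cVal_le_lev hj).trans p.cVal_le_len)

theorem codes_of_mem (ha : a ∈ p.body) {j : ℕ} (hj : j < p.lev) {i : ℕ}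
    (hi : i ≤ cVal e a.1 j) : M (kVal a.1 j) i = a.2 i := by
  rw [cVal_of_mem ha hj.le] at hi
  rw [kVal_of_mem ha hj, p.codes j hj i hi,
    ha.2.1 i (hi.trans_lt (cVal_lt e p.x p.lvl1Zero_of_lt hj))]

theorem memY3_of_mem (ha : a ∈ p.body) (h : ¬ lvl1Zero a.1 p.lev) : memY3 e M a := by
  intro m hm i hi
  refine codes_of_mem ha ?_ hi
  by_contra! hle
  exact h (natCast_lt_nVal.1 hm _ hle)

/-- Any point of the body can be approximated by a condition of the next level. -/
theorem exists_extension (hM : DenseRange M) (ha : a ∈ p.body) (L : ℕ) :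
    ∃ q : Cond e M, q.lev = p.lev + 1 ∧ q.body ⊆ p.body ∧ ∀ b ∈ q.body, AgreeBelow e L a b := by
  wlog hL : p.len ≤ L generalizing L
  · obtain ⟨q, h₁, h₂, h₃⟩ := this (max L p.len) (le_max_right _ _)
    exact ⟨q, h₁, h₂, fun b hb => ⟨fun r hr => (h₃ b hb).1 r (by omega),
      fun i hi => (h₃ b hb).2 i (by omega)⟩⟩
  set m := p.lev with hm
  obtain ⟨K, hK⟩ := exists_bound_index e L
  obtain ⟨k, hkK, hk⟩ := exists_ge_code hM a.2 (cVal e p.x m) (K + 1)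
  let x : ℕ × ℕ × ℕ → Bool :=
    fun r => if L ≤ e.symm r ∧ r.1 = m then decide (r.2.1 ≠ k) else a.1 r
  have hxa : ∀ r, e.symm r < L → x r = a.1 r := fun r hr => if_neg fun h => by omega
  have hx_row : ∀ r : ℕ × ℕ × ℕ, r.1 < m → x r = a.1 r := fun r hr => if_neg fun h => by omega
  have hx : (x, a.2) ∈ p.body :=
    ⟨fun r hr => (hxa r (by omega)).trans (ha.1 r hr), ha.2.1,
      fun j hj i => (hx_row _ hj).trans (ha.2.2 j hj i)⟩
  have hzero : ¬ lvl2Zero x m k := by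
    rintro ⟨i, hi⟩
    have : L ≤ e.symm (m, k, i) := by
      by_contra! hlt
      have := (hK _ _ _ hlt).1
      omega
    simp [x, this] at hi
  have hone : ∀ k' < k, lvl2Zero x m k' := fun k' hk' => by
    obtain ⟨i, hi⟩ := exists_index_ge e L m k'
    exact ⟨i, by simp [x, hi, hk'.ne]⟩
  have hkx : kVal x m = k := kVal_eq hzero hone
  have hlvl : ∀ j < m + 1, lvl1Zero x j := fun j hj => by
    rcases Nat.lt_succ_iff_lt_or_eq.1 hj with hj | rfl
    · exact lvl1Zero_of_mem hx hj
    · exact ⟨k, hzero⟩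
  have hc : L < cVal e x (m + 1) := by
    by_contra! hle
    have h₁ := (sqSub_cVal e x hlvl).2.2 m (by omega)
    have h₂ : kSeg e x (cVal e x (m + 1)) m ≤ K := kSeg_le e x fun i hi => by
      have := (hK _ _ _ (hi.trans_le hle)).1
      omega
    omega
  let q : Cond e M :=
    { x := x, y := a.2, len := max L (cVal e x (m + 1)), lev := m + 1
      lvl1Zero_of_lt := hlvl
      cVal_le_len := le_max_right _ _
      codes := fun j hj i hi => by
        rcases Nat.lt_succ_iff_lt_or_eq.1 hj with hj | rfl
        · exact codes_of_mem hx hj hi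
        · rw [hkx]
          exact hk i (hi.trans_eq (cVal_of_mem hx le_rfl)) }
  have hagree : ∀ b ∈ q.body, AgreeBelow e L a b := fun b hb =>
    ⟨fun r hr => (hb.1 r (lt_max_of_lt_left hr)).trans (hxa r hr),
      fun i hi => hb.2.1 i (hi.trans hc)⟩
  refine ⟨q, rfl, fun b hb => ⟨fun r hr => ?_, fun i hi => ?_, fun j hj i => ?_⟩, hagree⟩
  · rw [(hagree b hb).1 r (by omega), ha.1 r hr]
  · have := p.cVal_le_len
    rw [(hagree b hb).2 i (by omega), ha.2.1 i hi]
  · have := hb.2.2 j (Nat.lt_succ_of_lt hj) i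
    rwa [← kVal_of_mem hx hj]

/-- Any point of the body can be approximated by a point of the body with `n^x` equal to the
level. -/
theorem exists_not_lvl1Zero (ha : a ∈ p.body) (L : ℕ) :
    ∃ b ∈ p.body, AgreeBelow e L a b ∧ ¬ lvl1Zero b.1 p.lev := by
  let x : ℕ × ℕ × ℕ → Bool :=
    fun r => if max L p.len ≤ e.symm r ∧ r.1 = p.lev then true else a.1 r
  have hxa : ∀ r, e.symm r < max L p.len → x r = a.1 r := fun r hr => if_neg fun h => by omega
  refine ⟨(x, a.2), ⟨fun r hr => (hxa r (lt_max_of_lt_right hr)).trans (ha.1 r hr), ha.2.1,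
    fun j hj i => (if_neg fun h => ?_ : x _ = a.1 _).trans (ha.2.2 j hj i)⟩,
    ⟨fun r hr => hxa r (lt_max_of_lt_left hr), fun _ _ => rfl⟩, ?_⟩
  · have := h.2
    simp only at this
    omega
  · rintro ⟨k, hk⟩
    obtain ⟨i, hi⟩ := exists_index_ge e (max L p.len) p.lev k
    exact hk ⟨i, if_pos ⟨hi, rfl⟩⟩

/-- Flip the bit of the second coordinate at position `c`. -/
def flip (c : ℕ) (a : XThree) : XThree := (a.1, Function.update a.2 c (!a.2 c))

theorem continuous_flip (c : ℕ) : Continuous (flip c) := by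
  have : Continuous fun b : Bool => !b := continuous_of_discreteTopology
  unfold flip
  fun_prop

theorem flip_flip (c : ℕ) (a : XThree) : flip c (flip c a) = a := by
  ext1
  · rfl
  · simp [flip]

theorem flip_mem (ha : a ∈ p.body) : flip (cVal e p.x p.lev) a ∈ p.body :=
  ⟨ha.1, fun i hi => by simp [flip, hi.ne, ha.2.1 i hi], ha.2.2⟩

theorem agreeBelow_flip {L c : ℕ} (hc : c < L) (h : AgreeBelow e L (flip c a) b) :
    AgreeBelow e L a (flip c b) := by
  refine ⟨h.1, fun i hi => ?_⟩
  have hb := h.2 i hi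
  by_cases hic : i = c
  · subst hic
    simp [flip, hb]
  · simpa [flip, hic] using hb

theorem dense_subtype {S : Set XThree}
    (h : ∀ a ∈ p.body, ∀ L, ∃ b ∈ p.body, AgreeBelow e L a b ∧ b ∈ S) :
    Dense ((↑) ⁻¹' S : Set p.body) := by
  rw [dense_iff_inter_open]
  rintro _ ⟨V, hV, rfl⟩ ⟨a, ha⟩
  obtain ⟨L, hL⟩ := exists_agreeBelow_subset e hV ha
  obtain ⟨b, hb, hab, hbS⟩ := h a a.2 L
  exact ⟨⟨b, hb⟩, hL b hab, hbS⟩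

theorem isGδ_not_lvl1Zero (m : ℕ) : IsGδ {a : XThree | ¬ lvl1Zero a.1 m} := by
  have : {a : XThree | ¬ lvl1Zero a.1 m} = ⋂ k, ⋃ i, {a : XThree | a.1 (m, k, i) = true} := by
    ext a
    simp [lvl1Zero, lvl2Zero]
  rw [this]
  refine IsGδ.iInter_of_isOpen fun k => isOpen_iUnion fun i => ?_
  exact (isOpen_discrete ({true} : Set Bool)).preimage
    (f := fun a : XThree => a.1 (m, k, i)) (by fun_prop)

theorem h3Edge_flip (ha : a ∈ p.body) (h : ¬ lvl1Zero a.1 p.lev)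
    (hc : a.2 (cVal e p.x p.lev) = false) : H3Edge e M a (flip (cVal e p.x p.lev) a) := by
  refine ⟨memY3_of_mem ha h, memY3_of_mem (flip_mem ha) h, rfl, p.lev,
    nVal_eq (fun j hj => lvl1Zero_of_mem ha hj) h, ?_⟩
  rw [cVal_of_mem ha le_rfl]
  exact ⟨hc, by simp [flip, hc], fun i hi => by simp [flip, hi]⟩

/-- Every condition has an extension that avoids a given independent `Gδ` set. -/
theorem exists_avoiding (hM : DenseRange M) {G : Set XThree} (hG : IsGδ G)
    (hind : ∀ a b, H3Edge e M a b → ¬ (a ∈ G ∧ b ∈ G)) (p : Cond e M) :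
    ∃ q : Cond e M, q.lev = p.lev + 1 ∧ q.body ⊆ p.body ∧
      ∀ a ∈ q.body, memY3 e M a → a ∉ G := by
  by_contra! hcon
  set c := cVal e p.x p.lev
  have key : ∀ a ∈ p.body, ∀ L, ∃ b ∈ p.body, AgreeBelow e L a b ∧ b ∈ G := by
    intro a ha L
    obtain ⟨q, hq₁, hq₂, hq₃⟩ := exists_extension hM ha L
    obtain ⟨b, hb, -, hbG⟩ := hcon q hq₁ hq₂
    exact ⟨b, hq₂ hb, hq₃ b hb, hbG⟩
  have key_flip : ∀ a ∈ p.body, ∀ L, ∃ b ∈ p.body, AgreeBelow e L a b ∧ b ∈ flip c ⁻¹' G := by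
    intro a ha L
    obtain ⟨b, hb, hab, hbG⟩ := key _ (flip_mem ha) (max L (c + 1))
    have h := agreeBelow_flip (c := c) (by omega) hab
    exact ⟨flip c b, flip_mem hb, ⟨fun r hr => h.1 r (lt_max_of_lt_left hr),
      fun i hi => h.2 i (lt_max_of_lt_left hi)⟩, by rwa [Set.mem_preimage, flip_flip]⟩
  have : CompactSpace p.body := isCompact_iff_compactSpace.1 p.isClosed_body.isCompact
  have : Nonempty p.body := ⟨⟨_, p.mem_body_self⟩⟩
  have hGF := hG.preimage (continuous_flip c)
  have hd := (dense_subtype key).inter_of_Gδ (hG.preimage continuous_subtype_val)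
    (hGF.preimage continuous_subtype_val) (dense_subtype key_flip)
  have hd' := hd.inter_of_Gδ ((hG.preimage continuous_subtype_val).inter
    (hGF.preimage continuous_subtype_val))
    ((isGδ_not_lvl1Zero p.lev).preimage continuous_subtype_val)
    (dense_subtype fun a ha L => exists_not_lvl1Zero ha L)
  obtain ⟨⟨a, ha⟩, ⟨haG, haF⟩, hn⟩ := hd'.nonempty
  cases hac : a.2 c with
  | false => exact hind _ _ (h3Edge_flip ha hn hac) ⟨haG, haF⟩
  | true =>
    have hedge := h3Edge_flip (flip_mem ha) hn (by simp [flip, c, hac])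
    rw [flip_flip] at hedge
    exact hind _ _ hedge ⟨haF, haG⟩

/-- The trivial condition. -/
noncomputable def trivial (e : ℕ ≃ ℕ × ℕ × ℕ) (M : ℕ → ℕ → Bool) : Cond e M where
  x _ := false
  y _ := false
  len := cVal e (fun _ => false) 0
  lev := 0
  lvl1Zero_of_lt j hj := absurd hj j.not_lt_zero
  cVal_le_len := le_rfl
  codes j hj := absurd hj j.not_lt_zero

end Cond

/-- There is no countable `Σ^0_3` colouring of `H₃`: no countable
family of `Σ^0_3` subsets of `X₃` covers `Y₃` while each member omits at least one
endpoint of every `H₃`-edge. -/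
theorem H3_not_sigma3_colourable (e : ℕ ≃ ℕ × ℕ × ℕ) (M : ℕ → ℕ → Bool)
    (hM : DenseRange M) :
    ¬ ∃ C : ℕ → Set XThree,
      (∀ n : ℕ, SigmaClass XThree 3 (C n)) ∧
      ({a : XThree | memY3 e M a} ⊆ ⋃ n : ℕ, C n) ∧
      (∀ (n : ℕ) (a b : XThree), H3Edge e M a b → ¬ (a ∈ C n ∧ b ∈ C n)) := by
  rintro ⟨C, hC, hcov, hind⟩
  choose G hCG hG using fun n => (hC n).exists_iUnion_isGδ
  let G' : ℕ → Set XThree := fun n => G n.unpair.1 n.unpair.2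
  have hindG : ∀ n a b, H3Edge e M a b → ¬ (a ∈ G' n ∧ b ∈ G' n) := fun n a b hab ⟨ha, hb⟩ =>
    hind n.unpair.1 a b hab
      ⟨hCG _ ▸ Set.mem_iUnion_of_mem _ ha, hCG _ ▸ Set.mem_iUnion_of_mem _ hb⟩
  choose f hlev hsub havoid using fun n => Cond.exists_avoiding hM (hG _ _) (hindG n)
  let P : ℕ → Cond e M := fun n => Nat.rec (Cond.trivial e M) f n
  have hP : ∀ n, (P n).lev = n := fun n => by
    induction n with
    | zero => rfl
    | succ n ih => exact (hlev n (P n)).trans (by rw [ih])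
  obtain ⟨a, ha⟩ := IsCompact.nonempty_iInter_of_sequence_nonempty_isCompact_isClosed
    (fun n => (P n).body) (fun n => hsub n (P n)) (fun n => ⟨_, (P n).mem_body_self⟩)
    (P 0).isClosed_body.isCompact fun n => (P n).isClosed_body
  rw [Set.mem_iInter] at ha
  have haY : memY3 e M a := fun m _ i hi =>
    Cond.codes_of_mem (ha (m + 1)) (m.lt_succ_self.trans_eq (hP _).symm) hi
  obtain ⟨n, hn⟩ := Set.mem_iUnion.1 (hcov haY)
  rw [hCG, Set.mem_iUnion] at hn
  obtain ⟨k, hk⟩ := hn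
  refine havoid (Nat.pair n k) (P _) a (ha (Nat.pair n k + 1)) haY ?_
  simpa [G'] using hk
end
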